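/- Let u₁, …, u_k ∈ S and let u = α₁·u₁ + ⋯ + α_k·u_k with nonnegative integers αᵢ. Then X^{ss}(u) = ⋂_{i : αᵢ ≠ 0} X^{ss}(uᵢ) (where the intersection over the empty index set is all of Spec A, and indeed X^{ss}(0) = Spec A). -/

import Mathlib

open scoped BigOperators

/-- The character `χ^s` in the monoid algebra `ℂ[S]`. -/
noncomputable def chi {n : ℕ} (S : AddSubmonoid (Fin n → ℤ)) (s : S) :
    AddMonoidAlgebra ℂ S :=
  AddMonoidAlgebra.single s 1

/-- The homogeneous component of degree `m ∈ M = ℤ^n` of the `M`-graded algebra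
`A = ℂ[S]`: it is `ℂ · χ^m` if `m ∈ S` and `0` otherwise. -/
noncomputable def homComponent {n : ℕ} (S : AddSubmonoid (Fin n → ℤ)) (m : Fin n → ℤ) :
    Submodule ℂ (AddMonoidAlgebra ℂ S) :=
  Submodule.span ℂ {f | ∃ s : S, (s : Fin n → ℤ) = m ∧ f = chi S s}

/-- The semistable locus `X^{ss}(u) ⊆ Spec A`: the union of the basic open sets `D(f)`
over all integers `k > 0` and all `f` in the component of degree `k • u`. -/
noncomputable def ssLocus {n : ℕ} (S : AddSubmonoid (Fin n → ℤ)) (u : Fin n → ℤ) :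
    Set (PrimeSpectrum (AddMonoidAlgebra ℂ S)) :=
  ⋃ (k : ℕ) (_ : 0 < k) (f ∈ homComponent S (k • u)), {p | f ∉ p.asIdeal}


theorem chi_add {n : ℕ} (S : AddSubmonoid (Fin n → ℤ)) (s t : S) :
    chi S (s + t) = chi S s * chi S t := by
  simp [chi, AddMonoidAlgebra.single_mul_single]

theorem chi_zero {n : ℕ} (S : AddSubmonoid (Fin n → ℤ)) : chi S 0 = 1 := rfl

theorem chi_nsmul {n : ℕ} (S : AddSubmonoid (Fin n → ℤ)) (k : ℕ) (s : S) :
    chi S (k • s) = chi S s ^ k := by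
  induction k with
  | zero => simp [chi_zero]
  | succ k ih => rw [succ_nsmul, chi_add, ih, pow_succ]

theorem chi_sum {n : ℕ} (S : AddSubmonoid (Fin n → ℤ)) {ι : Type} (t : Finset ι) (g : ι → S) :
    chi S (∑ i ∈ t, g i) = ∏ i ∈ t, chi S (g i) := by
  classical
  induction t using Finset.induction_on with
  | empty => simp [chi_zero]
  | insert a t ha ih => rw [Finset.sum_insert ha, Finset.prod_insert ha, chi_add, ih]

theorem mem_ssLocus {n : ℕ} (S : AddSubmonoid (Fin n → ℤ)) (s : S)
    (p : PrimeSpectrum (AddMonoidAlgebra ℂ S)) :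
    p ∈ ssLocus S (s : Fin n → ℤ) ↔ chi S s ∉ p.asIdeal := by
  simp only [ssLocus, Set.mem_iUnion, Set.mem_setOf_eq]
  constructor
  · rintro ⟨k, hk, f, hf, hfp⟩ h
    apply hfp
    have hle : homComponent S (k • (s : Fin n → ℤ)) ≤ p.asIdeal.restrictScalars ℂ := by
      refine Submodule.span_le.2 ?_
      rintro _ ⟨t, ht, rfl⟩
      have : t = k • s := Subtype.ext (by simpa using ht)
      subst this
      rw [chi_nsmul]
      exact Ideal.pow_mem_of_mem _ h k hk
    exact hle hf
  · intro h
    exact ⟨1, one_pos, chi S s, Submodule.subset_span ⟨s, by simp, rfl⟩, h⟩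

/-- If `u = α₁·u₁ + ⋯ + α_k·u_k` with `uᵢ ∈ S` and nonnegative integer coefficients `αᵢ`,
then `X^{ss}(u) = ⋂_{i : αᵢ ≠ 0} X^{ss}(uᵢ)`; moreover `X^{ss}(0) = Spec A`. -/
theorem semistable_of_sum {n : ℕ} (C : Set (Fin n → ℚ))
    (hpoly : ∃ (k : ℕ) (g : Fin k → (Fin n → ℚ)),
      C = {x | ∃ c : Fin k → ℚ, (∀ i, 0 ≤ c i) ∧ x = ∑ i, c i • g i})
    (hfull : Submodule.span ℚ C = ⊤)
    (S : AddSubmonoid (Fin n → ℤ))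
    (hS : (S : Set (Fin n → ℤ)) = {u : Fin n → ℤ | (fun i => (u i : ℚ)) ∈ C})
    (k : ℕ) (U : Fin k → S) (α : Fin k → ℕ) :
    ssLocus S (∑ i, α i • (U i : Fin n → ℤ)) =
      (⋂ (i : Fin k) (_ : α i ≠ 0), ssLocus S (U i : Fin n → ℤ)) ∧
    ssLocus S (0 : Fin n → ℤ) = Set.univ := by
  constructor
  · ext p
    have e : (∑ i, α i • (U i : Fin n → ℤ)) = ((∑ i, α i • U i : S) : Fin n → ℤ) := by
      simp
    rw [e, mem_ssLocus, chi_sum]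
    simp only [Set.mem_iInter, mem_ssLocus, chi_nsmul]
    rw [p.isPrime.prod_mem_iff]
    constructor
    · intro h i hi hp
      exact h ⟨i, Finset.mem_univ i, Ideal.pow_mem_of_mem _ hp _ (Nat.pos_of_ne_zero hi)⟩
    · rintro h ⟨i, -, hi⟩
      by_cases h0 : α i = 0
      · rw [h0, pow_zero] at hi
        exact p.isPrime.ne_top ((Ideal.eq_top_iff_one _).2 hi)
      · exact h i h0 (p.isPrime.mem_of_pow_mem _ hi)
  · ext p
    have e : (0 : Fin n → ℤ) = ((0 : S) : Fin n → ℤ) := rfl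
    rw [e, mem_ssLocus, chi_zero]
    simpa using fun h => p.isPrime.ne_top ((Ideal.eq_top_iff_one _).2 h)
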